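/- (Stability estimate (27) in Proposition 3.) Let δ > ((3 + √5)/2) Ū and let μ₀ be a Borel probability measure on Ω. For i = 1, 2, let θᵢ : Ω → ℝ be continuous with 0 ≤ θᵢ(x) ≤ Ū for all x ∈ Ω, and let mᵢ be a Borel probability measure on Ω satisfying mᵢ(A) = ∫_A δ / (δ − (θᵢ(x) − ∫_Ω θᵢ dmᵢ)) μ₀(dx) for every Borel set A ⊆ Ω. Then TV(m₁, m₂) ≤ (1 − δŪ/(δ − Ū)²)⁻¹ · (2δ/(δ − Ū)²) · sup_{x ∈ Ω} |θ₁(x) − θ₂(x)|. -/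

import Mathlib

open MeasureTheory

/-- The action space `Ω = [0,1] ⊆ ℝ` with its Borel σ-algebra. -/
abbrev Ω : Type := Set.Icc (0:ℝ) 1

/-- Total variation distance between two (finite) Borel measures on `Ω`:
the total mass of the total variation of `μ − ν`, expressed via the Jordan
decomposition as `(μ − ν)(Ω) + (ν − μ)(Ω)` (truncated measure subtraction). -/
noncomputable def TV (μ ν : Measure Ω) : ℝ :=
  ((μ - ν) Set.univ + (ν - μ) Set.univ).toReal

/-- Continuous functions on the compact interval are integrable. -/
theorem omega_int (μ : Measure Ω) [IsFiniteMeasure μ] {f : Ω → ℝ} (hf : Continuous f) :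
    Integrable f μ :=
  hf.integrable_of_hasCompactSupport (HasCompactSupport.of_compactSpace f)

theorem omega_eq_withDensity (μ m : Measure Ω) [IsFiniteMeasure μ] (g : Ω → ℝ)
    (hg : Continuous g) (hg0 : ∀ x, 0 ≤ g x)
    (h : ∀ A : Set Ω, MeasurableSet A → m A = ENNReal.ofReal (∫ x in A, g x ∂μ)) :
    m = μ.withDensity (fun x => ENNReal.ofReal (g x)) := by
  ext A hA
  rw [h A hA, withDensity_apply _ hA,
    ofReal_integral_eq_lintegral_ofReal (omega_int μ hg).integrableOn
      (Filter.Eventually.of_forall hg0)]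

theorem omega_integral_withDensity (μ : Measure Ω) (g f : Ω → ℝ)
    (hg : Continuous g) (hg0 : ∀ x, 0 ≤ g x) :
    ∫ x, f x ∂(μ.withDensity (fun x => ENNReal.ofReal (g x))) = ∫ x, g x * f x ∂μ := by
  rw [integral_withDensity_eq_integral_toReal_smul hg.measurable.ennreal_ofReal
    (Filter.Eventually.of_forall fun x => ENNReal.ofReal_lt_top)]
  refine integral_congr_ae (Filter.Eventually.of_forall fun x => ?_)
  simp [ENNReal.toReal_ofReal (hg0 x)]

theorem omega_sub_le (μ : Measure Ω) [IsFiniteMeasure μ] (g h : Ω → ℝ)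
    (hg : Continuous g) (hh : Continuous h) :
    (μ.withDensity (fun x => ENNReal.ofReal (g x)) - μ.withDensity (fun x => ENNReal.ofReal (h x)))
      Set.univ ≤ ∫⁻ x, ENNReal.ofReal (g x - h x) ∂μ := by
  have hmeas : Measurable (fun x => ENNReal.ofReal (g x - h x)) :=
    (hg.sub hh).measurable.ennreal_ofReal
  have key : μ.withDensity (fun x => ENNReal.ofReal (g x)) -
      μ.withDensity (fun x => ENNReal.ofReal (h x)) ≤
      μ.withDensity (fun x => ENNReal.ofReal (g x - h x)) := by
    apply Measure.sub_le_of_le_add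
    rw [← withDensity_add_left hmeas]
    refine withDensity_mono (Filter.Eventually.of_forall fun x => ?_)
    simp only [Pi.add_apply]
    calc ENNReal.ofReal (g x) = ENNReal.ofReal ((g x - h x) + h x) := by ring_nf
      _ ≤ _ := ENNReal.ofReal_add_le
  refine (key Set.univ).trans ?_
  rw [withDensity_apply _ MeasurableSet.univ, Measure.restrict_univ]

theorem omega_TV_le (μ : Measure Ω) [IsFiniteMeasure μ] (g h : Ω → ℝ)
    (hg : Continuous g) (hh : Continuous h) :
    TV (μ.withDensity (fun x => ENNReal.ofReal (g x)))
      (μ.withDensity (fun x => ENNReal.ofReal (h x))) ≤ ∫ x, |g x - h x| ∂μ := by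
  have hmeas : Measurable (fun x => ENNReal.ofReal (g x - h x)) :=
    (hg.sub hh).measurable.ennreal_ofReal
  unfold TV
  apply ENNReal.toReal_le_of_le_ofReal (integral_nonneg fun x => abs_nonneg _)
  refine (add_le_add (omega_sub_le μ g h hg hh) (omega_sub_le μ h g hh hg)).trans ?_
  rw [← lintegral_add_left hmeas,
    ofReal_integral_eq_lintegral_ofReal (omega_int μ (f := fun x => |g x - h x|) (hg.sub hh).abs)
      (Filter.Eventually.of_forall fun x => abs_nonneg _)]
  refine lintegral_mono fun x => ?_
  rcases le_total (g x) (h x) with h1 | h1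
  · rw [ENNReal.ofReal_of_nonpos (sub_nonpos.2 h1), zero_add]
    exact ENNReal.ofReal_le_ofReal (by rw [abs_sub_comm]; exact le_abs_self _)
  · rw [ENNReal.ofReal_of_nonpos (sub_nonpos.2 h1), add_zero]
    exact ENNReal.ofReal_le_ofReal (le_abs_self _)

/-- **Stability estimate (27) in Proposition 3.** -/
theorem stmt7
    (Ubar : ℝ) (hUbar : 0 < Ubar)
    (δ : ℝ) (hδ : (3 + Real.sqrt 5) / 2 * Ubar < δ)
    (μ0 : Measure Ω) [IsProbabilityMeasure μ0]
    (θ₁ θ₂ : Ω → ℝ) (hθc₁ : Continuous θ₁) (hθc₂ : Continuous θ₂)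
    (hθ₁ : ∀ x, 0 ≤ θ₁ x ∧ θ₁ x ≤ Ubar) (hθ₂ : ∀ x, 0 ≤ θ₂ x ∧ θ₂ x ≤ Ubar)
    (m₁ m₂ : Measure Ω) [IsProbabilityMeasure m₁] [IsProbabilityMeasure m₂]
    (hm₁ : ∀ A : Set Ω, MeasurableSet A →
      m₁ A = ENNReal.ofReal (∫ x in A, δ / (δ - (θ₁ x - ∫ z, θ₁ z ∂m₁)) ∂μ0))
    (hm₂ : ∀ A : Set Ω, MeasurableSet A →
      m₂ A = ENNReal.ofReal (∫ x in A, δ / (δ - (θ₂ x - ∫ z, θ₂ z ∂m₂)) ∂μ0)) :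
    TV m₁ m₂ ≤ (1 - δ * Ubar / (δ - Ubar) ^ 2)⁻¹ * (2 * δ / (δ - Ubar) ^ 2) *
      ⨆ x : Ω, |θ₁ x - θ₂ x| := by
  have h5 : (2:ℝ) ≤ Real.sqrt 5 := by
    rw [Real.le_sqrt (by norm_num) (by norm_num)]; norm_num
  have h5s : Real.sqrt 5 ^ 2 = 5 := Real.sq_sqrt (by norm_num)
  have hδU : 0 < δ - Ubar := by nlinarith
  have hδ0 : 0 < δ := by linarith
  have hq : δ * Ubar < (δ - Ubar) ^ 2 := by
    have e : (δ - Ubar) ^ 2 - δ * Ubar =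
      (δ - (3 + Real.sqrt 5) / 2 * Ubar) * (δ - (3 - Real.sqrt 5) / 2 * Ubar) := by
      linear_combination ((Ubar ^ 2) / 4) * h5s
    have : 0 < (δ - (3 + Real.sqrt 5) / 2 * Ubar) * (δ - (3 - Real.sqrt 5) / 2 * Ubar) := by
      apply mul_pos
      · linarith
      · nlinarith
    linarith
  set c₁ := ∫ z, θ₁ z ∂m₁ with hc₁
  set c₂ := ∫ z, θ₂ z ∂m₂ with hc₂
  have hc₁0 : 0 ≤ c₁ := integral_nonneg fun x => (hθ₁ x).1
  have hc₂0 : 0 ≤ c₂ := integral_nonneg fun x => (hθ₂ x).1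
  have hd₁ : ∀ x, δ - Ubar ≤ δ - (θ₁ x - c₁) := fun x => by linarith [(hθ₁ x).2]
  have hd₂ : ∀ x, δ - Ubar ≤ δ - (θ₂ x - c₂) := fun x => by linarith [(hθ₂ x).2]
  have hp₁ : ∀ x, 0 < δ - (θ₁ x - c₁) := fun x => hδU.trans_le (hd₁ x)
  have hp₂ : ∀ x, 0 < δ - (θ₂ x - c₂) := fun x => hδU.trans_le (hd₂ x)
  set g₁ : Ω → ℝ := fun x => δ / (δ - (θ₁ x - c₁)) with hg₁
  set g₂ : Ω → ℝ := fun x => δ / (δ - (θ₂ x - c₂)) with hg₂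
  have cg₁ : Continuous g₁ := continuous_const.div (by fun_prop) fun x => (hp₁ x).ne'
  have cg₂ : Continuous g₂ := continuous_const.div (by fun_prop) fun x => (hp₂ x).ne'
  have pg₁ : ∀ x, 0 ≤ g₁ x := fun x => (div_pos hδ0 (hp₁ x)).le
  have pg₂ : ∀ x, 0 ≤ g₂ x := fun x => (div_pos hδ0 (hp₂ x)).le
  have em₁ := omega_eq_withDensity μ0 m₁ g₁ cg₁ pg₁ hm₁
  have em₂ := omega_eq_withDensity μ0 m₂ g₂ cg₂ pg₂ hm₂
  set S := ⨆ x : Ω, |θ₁ x - θ₂ x| with hS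
  have hbdd : BddAbove (Set.range fun x : Ω => |θ₁ x - θ₂ x|) :=
    (isCompact_range (hθc₁.sub hθc₂).abs).bddAbove
  have hSx : ∀ x, |θ₁ x - θ₂ x| ≤ S := fun x => le_ciSup hbdd x
  set T := ∫ x, |g₁ x - g₂ x| ∂μ0 with hT
  have hTV : TV m₁ m₂ ≤ T := by
    rw [em₁, em₂]; exact omega_TV_le μ0 g₁ g₂ cg₁ cg₂
  have i₁ : ∫ x, θ₂ x ∂m₁ = ∫ x, g₁ x * θ₂ x ∂μ0 := by
    rw [em₁]; exact omega_integral_withDensity μ0 g₁ θ₂ cg₁ pg₁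
  have i₂ : ∫ x, θ₂ x ∂m₂ = ∫ x, g₂ x * θ₂ x ∂μ0 := by
    rw [em₂]; exact omega_integral_withDensity μ0 g₂ θ₂ cg₂ pg₂
  have a₁ : |c₁ - ∫ x, θ₂ x ∂m₁| ≤ S := by
    rw [hc₁, ← integral_sub (omega_int m₁ hθc₁) (omega_int m₁ hθc₂)]
    have := norm_integral_le_of_norm_le_const (μ := m₁) (f := fun x => θ₁ x - θ₂ x) (C := S)
      (Filter.Eventually.of_forall hSx)
    simpa using this
  have a₂ : |(∫ x, θ₂ x ∂m₁) - c₂| ≤ Ubar * T := by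
    rw [hc₂, i₁, i₂, ← integral_sub (omega_int μ0 (f := fun x => g₁ x * θ₂ x) (cg₁.mul hθc₂))
        (omega_int μ0 (f := fun x => g₂ x * θ₂ x) (cg₂.mul hθc₂)),
      hT, ← integral_const_mul]
    refine abs_integral_le_integral_abs.trans ?_
    refine integral_mono (omega_int μ0 ((cg₁.mul hθc₂).sub (cg₂.mul hθc₂)).abs)
      (omega_int μ0 (continuous_const.mul (cg₁.sub cg₂).abs)) fun x => ?_
    show |g₁ x * θ₂ x - g₂ x * θ₂ x| ≤ Ubar * |g₁ x - g₂ x|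
    rw [← sub_mul, abs_mul, abs_of_nonneg (hθ₂ x).1, mul_comm]
    exact mul_le_mul_of_nonneg_right (hθ₂ x).2 (abs_nonneg _)
  have a₃ : |c₁ - c₂| ≤ S + Ubar * T :=
    (abs_sub_le c₁ (∫ x, θ₂ x ∂m₁) c₂).trans (add_le_add a₁ a₂)
  set K := δ / (δ - Ubar) ^ 2 with hK
  have hK0 : 0 ≤ K := by positivity
  have hpt : ∀ x, |g₁ x - g₂ x| ≤ K * (2 * S + Ubar * T) := by
    intro x
    have e : g₁ x - g₂ x = δ / ((δ - (θ₁ x - c₁)) * (δ - (θ₂ x - c₂))) *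
        ((θ₁ x - θ₂ x) - (c₁ - c₂)) := by
      have := (hp₁ x).ne'
      have := (hp₂ x).ne'
      simp only [hg₁, hg₂]
      rw [div_sub_div _ _ (hp₁ x).ne' (hp₂ x).ne', div_mul_eq_mul_div]
      congr 1
      ring
    rw [e, abs_mul, abs_of_pos (div_pos hδ0 (mul_pos (hp₁ x) (hp₂ x)))]
    have b : |(θ₁ x - θ₂ x) - (c₁ - c₂)| ≤ 2 * S + Ubar * T := by
      have := abs_sub (θ₁ x - θ₂ x) (c₁ - c₂)
      linarith [hSx x]
    refine mul_le_mul ?_ b (abs_nonneg _) hK0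
    rw [hK, sq]
    exact div_le_div_of_nonneg_left hδ0.le (by positivity)
      (mul_le_mul (hd₁ x) (hd₂ x) hδU.le (hp₁ x).le)
  have hTle : T ≤ K * (2 * S + Ubar * T) := by
    have := integral_mono (μ := μ0) (omega_int μ0 (cg₁.sub cg₂).abs)
      (integrable_const (K * (2 * S + Ubar * T))) hpt
    simpa using this
  have e1 : δ * Ubar / (δ - Ubar) ^ 2 = K * Ubar := by rw [hK]; ring
  have e2 : 2 * δ / (δ - Ubar) ^ 2 = 2 * K := by rw [hK]; ring
  have hlt : δ * Ubar / (δ - Ubar) ^ 2 < 1 := by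
    rw [div_lt_one (by positivity)]; exact hq
  rw [e1] at hlt
  rw [e1, e2, mul_assoc]
  refine hTV.trans ?_
  rw [← div_eq_inv_mul, le_div_iff₀ (by linarith)]
  linarith
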